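/- Von Neumann entropy cannot decrease under a correlated-catalytic unitary transformation: if there exist a density operator ω_C and a unitary U on H_S ⊗ H_C such that tr_C[U(ρ_S ⊗ ω_C)U†] = σ_S and tr_S[U(ρ_S ⊗ ω_C)U†] = ω_C, then H(σ_S) ≥ H(ρ_S), with equality iff the global output state is a product state σ_S ⊗ ω_C. -/

import Mathlib

open Matrix Kronecker
open scoped ComplexOrder Classical

/-- A density operator: positive semidefinite with unit trace. -/
def IsDensity {ι : Type} [Fintype ι] (A : Matrix ι ι ℂ) : Prop :=
  A.PosSemidef ∧ A.trace = 1

/-- The von Neumann entropy `H(ρ) = -tr[ρ log ρ]` of a Hermitian matrix,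
expressed through its eigenvalues. -/
noncomputable def vnEntropy {ι : Type} [Fintype ι] [DecidableEq ι]
    (A : Matrix ι ι ℂ) : ℝ :=
  if h : A.IsHermitian then ∑ i, Real.negMulLog (h.eigenvalues i) else 0

/-- Partial trace over the second tensor factor (trace out `C`). -/
noncomputable def trRight {ι κ : Type} [Fintype κ]
    (X : Matrix (ι × κ) (ι × κ) ℂ) : Matrix ι ι ℂ :=
  fun i i' => ∑ j, X (i, j) (i', j)

/-- Partial trace over the first tensor factor (trace out `S`). -/
noncomputable def trLeft {ι κ : Type} [Fintype ι]
    (X : Matrix (ι × κ) (ι × κ) ℂ) : Matrix κ κ ℂ :=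
  fun j j' => ∑ i, X (i, j) (i, j')

/-- The scalar inequality behind Klein's inequality. -/
lemma klein_term (p q s : ℝ) (hp : 0 ≤ p) (hq : 0 ≤ q) (hs : 0 ≤ s)
    (hker : q = 0 → p * s = 0) :
    s * (p - q) ≤ p * s * (Real.log p - Real.log q) ∧
    (s * (p - q) = p * s * (Real.log p - Real.log q) ↔ s * (p - q) = 0) := by
  rcases hs.eq_or_lt with rfl | hs'
  · simp
  rcases hq.eq_or_lt with rfl | hq'
  · have := hker rfl
    have hp0 : p = 0 := by
      rcases mul_eq_zero.1 this with h | h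
      · exact h
      · exact absurd h hs'.ne'
    simp [hp0]
  rcases hp.eq_or_lt with rfl | hp'
  · have : 0 < s * q := mul_pos hs' hq'
    constructor
    · simp; exact this.le
    · simp
  have key : p - q ≤ p * (Real.log p - Real.log q) := by
    have := Real.log_le_sub_one_of_pos (div_pos hq' hp')
    rw [Real.log_div hq'.ne' hp'.ne'] at this
    have h2 := mul_le_mul_of_nonneg_left this hp
    have h3 : p * (q / p - 1) = q - p := by field_simp
    nlinarith
  refine ⟨by nlinarith, ?_, ?_⟩
  · intro h
    by_cases hpq : p = q
    · simp [hpq]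
    exfalso
    have h1 : q / p ≠ 1 := by
      intro h; rw [div_eq_one_iff_eq hp'.ne'] at h; exact hpq h.symm
    have := Real.log_lt_sub_one_of_pos (div_pos hq' hp') h1
    rw [Real.log_div hq'.ne' hp'.ne'] at this
    have h2 := mul_lt_mul_of_pos_left this hp'
    have h3 : p * (q / p - 1) = q - p := by field_simp
    have h4 : p - q < p * (Real.log p - Real.log q) := by nlinarith
    nlinarith
  · intro h
    have : p = q := by
      rcases mul_eq_zero.1 h with h | h
      · exact absurd h hs'.ne'
      · linarith
    simp [this]

lemma klein_sum {α β : Type} [Fintype α] [Fintype β] (p : α → ℝ) (q : β → ℝ)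
    (S : α → β → ℝ) (hp : ∀ a, 0 ≤ p a) (hq : ∀ b, 0 ≤ q b) (hS : ∀ a b, 0 ≤ S a b)
    (hrow : ∀ a, ∑ b, S a b = 1) (hcol : ∀ b, ∑ a, S a b = 1)
    (hpq : ∑ a, p a = ∑ b, q b)
    (hker : ∀ a b, q b = 0 → p a * S a b = 0) :
    ∑ a, Real.negMulLog (p a) ≤ -∑ b, (∑ a, p a * S a b) * Real.log (q b) ∧
    (-∑ b, (∑ a, p a * S a b) * Real.log (q b) = ∑ a, Real.negMulLog (p a) ↔
      ∀ a b, S a b * (p a - q b) = 0) := by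
  have e1 : ∑ a, ∑ b, S a b * (p a - q b) = 0 := by
    simp only [mul_sub, Finset.sum_sub_distrib]
    rw [Finset.sum_comm (f := fun a b => S a b * q b)]
    simp only [← Finset.sum_mul, hrow, hcol, one_mul, hpq, sub_self]
  have e2 : ∑ a, ∑ b, p a * S a b * (Real.log (p a) - Real.log (q b)) =
      -∑ b, (∑ a, p a * S a b) * Real.log (q b) - ∑ a, Real.negMulLog (p a) := by
    simp only [mul_sub, Finset.sum_sub_distrib]
    rw [Finset.sum_comm (f := fun a b => p a * S a b * Real.log (q b))]
    simp only [← Finset.sum_mul, ← Finset.mul_sum, hrow, mul_one, Real.negMulLog,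
      neg_mul, Finset.sum_neg_distrib]
    ring
  have ht := fun a b => klein_term (p a) (q b) (S a b) (hp a) (hq b) (hS a b) (hker a b)
  have e3 : ∑ a, ∑ b, S a b * (p a - q b) ≤
      ∑ a, ∑ b, p a * S a b * (Real.log (p a) - Real.log (q b)) :=
    Finset.sum_le_sum fun a _ => Finset.sum_le_sum fun b _ => (ht a b).1
  refine ⟨by linarith, ?_⟩
  have e4 : (∑ a, ∑ b, S a b * (p a - q b) =
      ∑ a, ∑ b, p a * S a b * (Real.log (p a) - Real.log (q b))) ↔
      ∀ a b, S a b * (p a - q b) = 0 := by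
    rw [Finset.sum_eq_sum_iff_of_le
      (fun a _ => Finset.sum_le_sum fun b _ => (ht a b).1)]
    refine ⟨fun h a b => ?_, fun h a _ => ?_⟩
    · have := h a (Finset.mem_univ _)
      rw [Finset.sum_eq_sum_iff_of_le (fun b _ => (ht a b).1)] at this
      exact (ht a b).2.1 (this b (Finset.mem_univ _))
    · exact Finset.sum_congr rfl fun b _ => (ht a b).2.2 (h a b)
  rw [← e4]
  constructor <;> intro h <;> linarith

lemma sum_diag_right {ι κ : Type} [Fintype ι] [Fintype κ] [DecidableEq κ]
    (X : Matrix ι ι ℂ) (Y : Matrix κ κ ℂ) (hY : Y * Yᴴ = 1)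
    (T : Matrix (ι × κ) (ι × κ) ℂ) (j : ι) :
    ∑ l, ((X ⊗ₖ Y)ᴴ * T * (X ⊗ₖ Y)) (j, l) (j, l) = (Xᴴ * trRight T * X) j j := by
  have hY' : ∀ k k', ∑ l, star (Y k l) * Y k' l = if k' = k then 1 else 0 := by
    intro k k'
    have := congrFun (congrFun hY k') k
    rw [Matrix.mul_apply, Matrix.one_apply] at this
    rw [← this]
    exact Finset.sum_congr rfl fun l _ => by rw [Matrix.conjTranspose_apply, mul_comm]
  simp only [Matrix.mul_apply, Matrix.conjTranspose_apply, Matrix.kroneckerMap_apply,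
    Finset.sum_mul, star_mul', trRight, Fintype.sum_prod_type, Finset.mul_sum]
  rw [Finset.sum_comm]
  refine Finset.sum_congr rfl fun i' _ => ?_
  calc _ = ∑ k', ∑ i, ∑ k, ∑ l, star (X i j) * T (i, k) (i', k') * X i' j
            * (star (Y k l) * Y k' l) := by
        rw [Finset.sum_comm]
        refine Finset.sum_congr rfl fun k' _ => ?_
        rw [Finset.sum_comm]
        refine Finset.sum_congr rfl fun i _ => ?_
        rw [Finset.sum_comm]
        refine Finset.sum_congr rfl fun k _ => Finset.sum_congr rfl fun l _ => ?_
        ring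
    _ = _ := by
        simp only [← Finset.mul_sum, hY']
        rw [Finset.sum_comm]
        simp

lemma sum_diag_left {ι κ : Type} [Fintype ι] [Fintype κ] [DecidableEq ι]
    (X : Matrix ι ι ℂ) (Y : Matrix κ κ ℂ) (hX : X * Xᴴ = 1)
    (T : Matrix (ι × κ) (ι × κ) ℂ) (l : κ) :
    ∑ j, ((X ⊗ₖ Y)ᴴ * T * (X ⊗ₖ Y)) (j, l) (j, l) = (Yᴴ * trLeft T * Y) l l := by
  rw [show trLeft T = trRight (T.submatrix Prod.swap Prod.swap) from rfl,
    ← sum_diag_right Y X hX]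
  refine Finset.sum_congr rfl fun j _ => ?_
  simp only [Matrix.mul_apply, Matrix.conjTranspose_apply, Matrix.kroneckerMap_apply,
    Matrix.submatrix_apply]
  rw [← (Equiv.prodComm κ ι).sum_comp]
  refine Finset.sum_congr rfl fun x _ => ?_
  rw [← (Equiv.prodComm κ ι).sum_comp]
  simp [mul_comm]

/-- spectral data of a Hermitian matrix -/
lemma spectral_data {ι : Type} [Fintype ι] [DecidableEq ι] (A : Matrix ι ι ℂ)
    (hA : IsDensity A) :
    ∃ (V : Matrix ι ι ℂ) (r : ι → ℝ), Vᴴ * V = 1 ∧ V * Vᴴ = 1 ∧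
      A = V * diagonal (fun i => (r i : ℂ)) * Vᴴ ∧ (∀ i, 0 ≤ r i) ∧ ∑ i, r i = 1 ∧
      vnEntropy A = ∑ i, Real.negMulLog (r i) := by
  have h := hA.1.isHermitian
  have h1 : (h.eigenvectorUnitary : Matrix ι ι ℂ)ᴴ * h.eigenvectorUnitary = 1 :=
    Unitary.coe_star_mul_self h.eigenvectorUnitary
  refine ⟨h.eigenvectorUnitary, h.eigenvalues, h1,
    Unitary.coe_mul_star_self h.eigenvectorUnitary, ?_, hA.1.eigenvalues_nonneg, ?_, ?_⟩
  · have := h.spectral_theorem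
    rw [Unitary.conjStarAlgAut_apply] at this
    exact this
  · have := h.trace_eq_sum_eigenvalues
    rw [hA.2] at this
    have h2 : ((∑ i, h.eigenvalues i : ℝ) : ℂ) = 1 := by
      rw [Complex.ofReal_sum]; exact this.symm
    exact Complex.ofReal_eq_one.1 h2
  · rw [vnEntropy, dif_pos h]

lemma conj_diag_apply {α β : Type} [Fintype α] [DecidableEq α] (M : Matrix α β ℂ) (p : α → ℝ)
    (b : β) : (Mᴴ * diagonal (fun a => (p a : ℂ)) * M) b b =
      ((∑ a, p a * Complex.normSq (M a b) : ℝ) : ℂ) := by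
  rw [Matrix.mul_apply]
  push_cast
  refine Finset.sum_congr rfl fun a _ => ?_
  rw [Matrix.mul_diagonal, Matrix.conjTranspose_apply, Complex.normSq_eq_conj_mul_self]
  simp only [Complex.star_def]
  ring

lemma col_sum {α : Type} [Fintype α] [DecidableEq α] (M : Matrix α α ℂ) (h : Mᴴ * M = 1)
    (b : α) : ∑ a, Complex.normSq (M a b) = 1 := by
  have := conj_diag_apply M (fun _ => 1) b
  simp only [Complex.ofReal_one, Matrix.diagonal_one, Matrix.mul_one, h, Matrix.one_apply_eq,
    one_mul] at this
  exact_mod_cast this.symm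

theorem vnEntropy_correlated_catalytic {n m : ℕ}
    (U : Matrix (Fin n × Fin m) (Fin n × Fin m) ℂ)
    (hU : U ∈ Matrix.unitaryGroup (Fin n × Fin m) ℂ)
    (ρS σS : Matrix (Fin n) (Fin n) ℂ) (ωC : Matrix (Fin m) (Fin m) ℂ)
    (hρ : IsDensity ρS) (hσ : IsDensity σS) (hω : IsDensity ωC)
    (hS : trRight (U * (ρS ⊗ₖ ωC) * Uᴴ) = σS)
    (hC : trLeft (U * (ρS ⊗ₖ ωC) * Uᴴ) = ωC) :
    vnEntropy ρS ≤ vnEntropy σS ∧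
    (vnEntropy σS = vnEntropy ρS ↔ U * (ρS ⊗ₖ ωC) * Uᴴ = σS ⊗ₖ ωC) := by
  obtain ⟨P, r, hP1, hP2, hPA, hr, hr1, hrH⟩ := spectral_data ρS hρ
  obtain ⟨Q, s, hQ1, hQ2, hQA, hs, hs1, hsH⟩ := spectral_data σS hσ
  obtain ⟨R, o, hR1, hR2, hRA, ho, ho1, -⟩ := spectral_data ωC hω
  have hU1 : Uᴴ * U = 1 := (Matrix.mem_unitaryGroup_iff' (A := U)).1 hU
  have hU2 : U * Uᴴ = 1 := (Matrix.mem_unitaryGroup_iff (A := U)).1 hU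
  set T := U * (ρS ⊗ₖ ωC) * Uᴴ with hT
  have kdiag : ∀ f : Fin n → ℝ, (diagonal (fun i => (f i : ℂ))) ⊗ₖ
      (diagonal (fun i => (o i : ℂ))) =
      diagonal (fun x : Fin n × Fin m => ((f x.1 * o x.2 : ℝ) : ℂ)) := by
    intro f
    rw [Matrix.diagonal_kronecker_diagonal]
    simp
  obtain ⟨V, hV⟩ : ∃ V, V = U * (P ⊗ₖ R) := ⟨_, rfl⟩
  obtain ⟨W, hW⟩ : ∃ W, W = Q ⊗ₖ R := ⟨_, rfl⟩
  have hW1 : Wᴴ * W = 1 := by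
    rw [hW, Matrix.conjTranspose_kronecker, ← Matrix.mul_kronecker_mul, hQ1, hR1,
      Matrix.one_kronecker_one]
  have hW2 : W * Wᴴ = 1 := _root_.mul_eq_one_comm.1 hW1
  have hV1 : Vᴴ * V = 1 := by
    rw [hV, Matrix.conjTranspose_mul, Matrix.mul_assoc, ← Matrix.mul_assoc Uᴴ, hU1,
      Matrix.one_mul, Matrix.conjTranspose_kronecker, ← Matrix.mul_kronecker_mul, hP1, hR1,
      Matrix.one_kronecker_one]
  have hV2 : V * Vᴴ = 1 := _root_.mul_eq_one_comm.1 hV1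
  obtain ⟨p, hp⟩ : ∃ p : Fin n × Fin m → ℝ, p = fun x => r x.1 * o x.2 := ⟨_, rfl⟩
  obtain ⟨q, hq⟩ : ∃ q : Fin n × Fin m → ℝ, q = fun x => s x.1 * o x.2 := ⟨_, rfl⟩
  have hTV : T = V * diagonal (fun x => (p x : ℂ)) * Vᴴ := by
    rw [hT, hPA]
    conv_lhs => rw [hRA]
    rw [Matrix.mul_kronecker_mul, Matrix.mul_kronecker_mul, kdiag, hV, hp,
      Matrix.conjTranspose_mul, Matrix.conjTranspose_kronecker]
    simp only [Matrix.mul_assoc]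
  have hBW : σS ⊗ₖ ωC = W * diagonal (fun x => (q x : ℂ)) * Wᴴ := by
    conv_lhs => rw [hQA, hRA]
    rw [Matrix.mul_kronecker_mul, Matrix.mul_kronecker_mul, kdiag, hW, hq,
      Matrix.conjTranspose_kronecker]
  obtain ⟨M, hM⟩ : ∃ M, M = Vᴴ * W := ⟨_, rfl⟩
  have hMH : Mᴴ = Wᴴ * V := by rw [hM, Matrix.conjTranspose_mul, Matrix.conjTranspose_conjTranspose]
  have hM1 : Mᴴ * M = 1 := by
    rw [hMH, hM, Matrix.mul_assoc, ← Matrix.mul_assoc V, hV2, Matrix.one_mul, hW1]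
  have hM2 : M * Mᴴ = 1 := _root_.mul_eq_one_comm.1 hM1
  obtain ⟨S, hSd⟩ : ∃ S : Fin n × Fin m → Fin n × Fin m → ℝ,
    S = fun a b => Complex.normSq (M a b) := ⟨_, rfl⟩
  have hS0 : ∀ a b, 0 ≤ S a b := fun a b => by rw [hSd]; exact Complex.normSq_nonneg _
  have hcol : ∀ b, ∑ a, S a b = 1 := fun b => by rw [hSd]; exact col_sum M hM1 b
  have hrow : ∀ a, ∑ b, S a b = 1 := fun a => by
    have := col_sum Mᴴ (by rw [Matrix.conjTranspose_conjTranspose]; exact hM2) a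
    simpa [hSd, Matrix.conjTranspose_apply, Complex.normSq_conj] using this
  obtain ⟨d, hd⟩ : ∃ d : Fin n × Fin m → ℝ, d = fun b => ∑ a, p a * S a b := ⟨_, rfl⟩
  have hWT : ∀ b, (Wᴴ * T * W) b b = (d b : ℂ) := by
    intro b
    rw [hd, hSd]
    simp only
    rw [← conj_diag_apply, hMH, hM, hTV]
    simp only [Matrix.mul_assoc]
  have hp0 : ∀ a, 0 ≤ p a := fun a => by rw [hp]; exact mul_nonneg (hr _) (ho _)
  have hq0 : ∀ a, 0 ≤ q a := fun a => by rw [hq]; exact mul_nonneg (hs _) (ho _)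
  have hd0 : ∀ b, 0 ≤ d b := fun b => by
    rw [hd]; exact Finset.sum_nonneg fun a _ => mul_nonneg (hp0 a) (hS0 a b)
  have diagEntry : ∀ {k : ℕ} (A X : Matrix (Fin k) (Fin k) ℂ) (f : Fin k → ℝ), Xᴴ * X = 1 →
      A = X * diagonal (fun i => (f i : ℂ)) * Xᴴ → ∀ j, (Xᴴ * A * X) j j = (f j : ℂ) := by
    intro k A X f hX hA j
    have : Xᴴ * A * X = (Xᴴ * X) * diagonal (fun i => (f i : ℂ)) * (Xᴴ * X) := by
      rw [hA]; simp only [Matrix.mul_assoc]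
    rw [this, hX]
    simp
  have hdS : ∀ j, ∑ l, d (j, l) = s j := by
    intro j
    have := sum_diag_right Q R hR2 T j
    rw [← hW, hS, diagEntry σS Q s hQ1 hQA] at this
    simp only [hWT] at this
    exact_mod_cast this
  have hdC : ∀ l, ∑ j, d (j, l) = o l := by
    intro l
    have := sum_diag_left Q R hQ2 T l
    rw [← hW, hC, diagEntry ωC R o hR1 hRA] at this
    simp only [hWT] at this
    exact_mod_cast this
  have hds0 : ∀ j l, s j = 0 → d (j, l) = 0 := fun j l h => by
    have := hdS j
    rw [h, Finset.sum_eq_zero_iff_of_nonneg (fun l _ => hd0 _)] at this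
    exact this l (Finset.mem_univ _)
  have hdo0 : ∀ j l, o l = 0 → d (j, l) = 0 := fun j l h => by
    have := hdC l
    rw [h, Finset.sum_eq_zero_iff_of_nonneg (fun l _ => hd0 _)] at this
    exact this j (Finset.mem_univ _)
  have hker : ∀ a b, q b = 0 → p a * S a b = 0 := by
    rintro a ⟨j, l⟩ h
    have hd' : d (j, l) = 0 := by
      rw [hq] at h
      rcases mul_eq_zero.1 h with h | h
      · exact hds0 j l h
      · exact hdo0 j l h
    rw [hd] at hd'
    exact (Finset.sum_eq_zero_iff_of_nonneg
      (fun a _ => mul_nonneg (hp0 a) (hS0 a _))).1 hd' a (Finset.mem_univ _)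
  have hpq : ∑ a, p a = ∑ b, q b := by
    rw [hp, hq]
    simp only [Fintype.sum_prod_type, ← Finset.mul_sum, ho1, mul_one, hr1, hs1]
  obtain ⟨k1, k2⟩ := klein_sum p q S hp0 hq0 hS0 hrow hcol hpq hker
  have f1 : ∑ a, Real.negMulLog (p a) = vnEntropy ρS + ∑ l, Real.negMulLog (o l) := by
    rw [hp, hrH]
    simp only [Real.negMulLog_mul, Fintype.sum_prod_type, Finset.sum_add_distrib,
      ← Finset.mul_sum, ← Finset.sum_mul, ho1, hr1, one_mul]
  have f2 : -∑ b, (∑ a, p a * S a b) * Real.log (q b) =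
      vnEntropy σS + ∑ l, Real.negMulLog (o l) := by
    have : ∀ b, (∑ a, p a * S a b) * Real.log (q b) =
        d b * Real.log (s b.1) + d b * Real.log (o b.2) := by
      rintro ⟨j, l⟩
      rw [show (∑ a, p a * S a (j, l)) = d (j, l) by rw [hd], hq]
      by_cases h1 : s j = 0
      · simp [hds0 j l h1]
      by_cases h2 : o l = 0
      · simp [hdo0 j l h2]
      simp only
      rw [Real.log_mul h1 h2, mul_add]
    simp only [this, Finset.sum_add_distrib]
    rw [hsH, Fintype.sum_prod_type, Fintype.sum_prod_type_right]
    simp only [← Finset.sum_mul, hdS, hdC, Real.negMulLog, neg_mul, Finset.sum_neg_distrib]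
    ring
  rw [f1, f2] at k1 k2
  refine ⟨by linarith, ?_⟩
  rw [add_left_inj] at k2
  rw [k2]
  have g1 : (∀ a b, S a b * (p a - q b) = 0) ↔
      diagonal (fun x => (p x : ℂ)) * M = M * diagonal (fun x => (q x : ℂ)) := by
    rw [← Matrix.ext_iff]
    refine forall₂_congr fun a b => ?_
    rw [Matrix.diagonal_mul, Matrix.mul_diagonal, hSd]
    simp only [mul_eq_zero, Complex.normSq_eq_zero, sub_eq_zero]
    rw [mul_comm (M a b), mul_eq_mul_right_iff, Complex.ofReal_inj, or_comm]
  rw [g1, hTV, hBW, hM]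
  generalize diagonal (fun x => (p x : ℂ)) = E
  generalize diagonal (fun x => (q x : ℂ)) = F
  constructor
  · intro h
    calc V * E * Vᴴ = V * (E * (Vᴴ * W)) * Wᴴ := by
          simp only [Matrix.mul_assoc, hW2, Matrix.mul_one]
      _ = (V * Vᴴ) * (W * F * Wᴴ) := by rw [h]; simp only [Matrix.mul_assoc]
      _ = _ := by rw [hV2, Matrix.one_mul]
  · intro h
    calc E * (Vᴴ * W) = (Vᴴ * V) * E * (Vᴴ * W) := by rw [hV1, Matrix.one_mul]
      _ = Vᴴ * (V * E * Vᴴ) * W := by simp only [Matrix.mul_assoc]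
      _ = Vᴴ * W * F := by rw [h]; simp only [Matrix.mul_assoc, hW1, Matrix.mul_one]
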